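/- arXiv:1307.8412 — 5 statements merged into one kernel-verified Lean document; each statement's English description precedes it below -/
import Mathlib

section
/- Let E and F be real Banach spaces and let ψ : E → F be an additive map (i.e., ψ(x+y) = ψ(x) + ψ(y) for all x, y ∈ E). If ψ is μ-measurable (measurable with respect to the completed σ-algebra) for every centered Gaussian measure μ on E, then ψ is continuous and ℝ-linear. -/
open MeasureTheory ProbabilityTheory

/-- A centered Gaussian measure on a real Banach space: a Borel probability measure under
which every continuous linear functional is normally distributed with mean `0` and
finite variance. -/
def IsCenteredGaussian {E : Type*} [NormedAddCommGroup E] [NormedSpace ℝ E]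
    [MeasurableSpace E] (μ : Measure E) : Prop :=
  IsProbabilityMeasure μ ∧ ∀ L : E →L[ℝ] ℝ, ∃ v : NNReal, μ.map L = gaussianReal 0 v

open Filter Topology
open scoped NNReal ENNReal

/-- The law of a sequence of independent standard Gaussian random variables. -/
noncomputable abbrev gaussianSeq : Measure (ℕ → ℝ) :=
  Measure.infinitePi fun _ ↦ gaussianReal 0 1

lemma map_eq_gaussianReal_of_ae_tendsto {Ω : Type*} [MeasurableSpace Ω] {P : Measure Ω}
    [IsProbabilityMeasure P] {X : ℕ → Ω → ℝ} {Z : Ω → ℝ} {v : ℕ → ℝ≥0} {w : ℝ≥0}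
    (hX : ∀ n, AEMeasurable (X n) P) (hZ : AEMeasurable Z P)
    (hlaw : ∀ n, P.map (X n) = gaussianReal 0 (v n)) (hv : Tendsto v atTop (𝓝 w))
    (hlim : ∀ᵐ ω ∂P, Tendsto (fun n ↦ X n ω) atTop (𝓝 (Z ω))) :
    P.map Z = gaussianReal 0 w := by
  have : IsProbabilityMeasure (P.map Z) := Measure.isProbabilityMeasure_map hZ
  refine Measure.ext_of_charFun (funext fun t ↦ ?_)
  have h := ProbabilityMeasure.tendsto_iff_tendsto_charFun.1
    (tendstoInDistribution_of_ae_tendsto hX hZ hlim).tendsto t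
  simp only [ProbabilityMeasure.coe_mk, hlaw, charFun_gaussianReal] at h
  refine tendsto_nhds_unique h ?_
  rw [charFun_gaussianReal]
  have hv' : Tendsto (fun n ↦ ((v n : ℝ) : ℂ)) atTop (𝓝 ((w : ℝ) : ℂ)) :=
    (Complex.continuous_ofReal.tendsto _).comp ((NNReal.continuous_coe.tendsto _).comp hv)
  exact (Complex.continuous_exp.tendsto _).comp
    (tendsto_const_nhds.sub ((hv'.mul_const _).div_const _))

lemma map_sum_mul_gaussianSeq (a : ℕ → ℝ) (n : ℕ) :
    gaussianSeq.map (fun ω ↦ ∑ k ∈ Finset.range n, ω k * a k) =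
      gaussianReal 0 (∑ k ∈ Finset.range n, ‖a k‖₊ ^ 2) := by
  have hind : iIndepFun (fun k (ω : ℕ → ℝ) ↦ ω k * a k) gaussianSeq :=
    iIndepFun_infinitePi (X := fun k (t : ℝ) ↦ t * a k) (by fun_prop)
  induction n with
  | zero => simp
  | succ n ih =>
    have hn : gaussianSeq.map (fun ω ↦ ω n * a n) = gaussianReal 0 (‖a n‖₊ ^ 2) := by
      have := Measure.map_map (μ := gaussianSeq) (g := fun t : ℝ ↦ t * a n)
        (f := fun ω : ℕ → ℝ ↦ ω n) (by fun_prop) (by fun_prop)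
      rw [Measure.infinitePi_map_eval, gaussianReal_map_mul_const] at this
      rw [← Function.comp_def (fun t : ℝ ↦ t * a n) (fun ω : ℕ → ℝ ↦ ω n), ← this]
      congr 1
      · simp
      · ext; simp
    have hsum : (fun ω : ℕ → ℝ ↦ ∑ k ∈ Finset.range n, ω k * a k) =
        ∑ k ∈ Finset.range n, fun ω : ℕ → ℝ ↦ ω k * a k := by ext; simp
    have h := gaussianReal_add_gaussianReal_of_indepFun (hsum ▸
      hind.indepFun_finsetSum_of_notMem (by fun_prop) (Finset.notMem_range_self (n := n))) ih hn
    rw [Finset.sum_range_succ, ← add_zero (0 : ℝ), ← h]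
    congr 1
    ext ω
    simp [Finset.sum_range_succ]

lemma ae_summable_gaussianSeq {a : ℕ → ℝ} (ha : Summable fun k ↦ ‖a k‖) :
    ∀ᵐ ω ∂gaussianSeq, Summable fun k ↦ ‖ω k * a k‖ := by
  have hc : ∫⁻ t, ‖t‖ₑ ∂gaussianReal 0 1 ≠ ∞ :=
    (IsGaussian.integrable_id (μ := gaussianReal 0 1)).2.ne
  have hk (k : ℕ) : ∫⁻ ω, ‖ω k * a k‖ₑ ∂gaussianSeq =
      (∫⁻ t, ‖t‖ₑ ∂gaussianReal 0 1) * ‖a k‖ₑ := by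
    simp_rw [enorm_mul]
    rw [lintegral_mul_const _ (by fun_prop),
      ← Measure.infinitePi_map_eval (fun _ : ℕ ↦ gaussianReal 0 1) k,
      lintegral_map (by fun_prop) (by fun_prop)]
  have hint : ∫⁻ ω, ∑' k, ‖ω k * a k‖ₑ ∂gaussianSeq ≠ ∞ := by
    rw [lintegral_tsum fun k ↦ Measurable.aemeasurable (by fun_prop)]
    simp_rw [hk]
    rw [ENNReal.tsum_mul_left]
    refine ENNReal.mul_ne_top hc ?_
    exact ENNReal.tsum_coe_ne_top_iff_summable.2 ((NNReal.summable_coe.1 ha))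
  filter_upwards [ae_lt_top (by fun_prop) hint] with ω hω
  exact NNReal.summable_coe.2 (ENNReal.tsum_coe_ne_top_iff_summable.1 hω.ne)

section GaussianSeries

variable {E : Type*} [NormedAddCommGroup E] [NormedSpace ℝ E] [CompleteSpace E] {x : ℕ → E}

lemma ae_summable_smul_gaussianSeq (hx : Summable fun k ↦ ‖x k‖) :
    ∀ᵐ ω ∂gaussianSeq, Summable fun k ↦ ω k • x k := by
  filter_upwards [ae_summable_gaussianSeq (a := fun k ↦ ‖x k‖) (by simpa using hx)] with ω hω
  exact .of_norm (by simpa [norm_smul] using hω)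

variable [MeasurableSpace E] [BorelSpace E]

lemma aemeasurable_tsum_smul_gaussianSeq (hx : Summable fun k ↦ ‖x k‖) :
    AEMeasurable (fun ω ↦ ∑' k, ω k • x k) gaussianSeq := by
  refine AEStronglyMeasurable.aemeasurable <| aestronglyMeasurable_of_tendsto_ae atTop
    (f := fun n (ω : ℕ → ℝ) ↦ ∑ k ∈ Finset.range n, ω k • x k) (fun n ↦ ?_) ?_
  · refine Finset.aestronglyMeasurable_fun_sum _ fun k _ ↦ ?_
    exact ((measurable_pi_apply k).aestronglyMeasurable).smul_const (x k)
  · filter_upwards [ae_summable_smul_gaussianSeq hx] with ω hω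
    exact hω.hasSum.tendsto_sum_nat

lemma isCenteredGaussian_map_tsum_smul (hx : Summable fun k ↦ ‖x k‖) :
    IsCenteredGaussian (gaussianSeq.map fun ω ↦ ∑' k, ω k • x k) := by
  have hX := aemeasurable_tsum_smul_gaussianSeq hx
  refine ⟨Measure.isProbabilityMeasure_map hX, fun L ↦ ?_⟩
  have hL : Summable fun k ↦ ‖L (x k)‖ := .of_nonneg_of_le (fun _ ↦ norm_nonneg _)
    (fun k ↦ L.le_opNorm (x k)) (hx.mul_left _)
  have hsq : Summable fun k ↦ ‖L (x k)‖₊ ^ 2 := by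
    rw [← NNReal.summable_coe]
    refine hL.of_norm_bounded_eventually_nat ?_
    filter_upwards [hL.tendsto_atTop_zero.eventually_le_const one_pos] with k hk
    simpa using pow_le_of_le_one (norm_nonneg _) hk two_ne_zero
  refine ⟨∑' k, ‖L (x k)‖₊ ^ 2, ?_⟩
  rw [AEMeasurable.map_map_of_aemeasurable L.continuous.measurable.aemeasurable hX]
  refine map_eq_gaussianReal_of_ae_tendsto
    (X := fun n ω ↦ ∑ k ∈ Finset.range n, ω k * L (x k)) (fun n ↦ Measurable.aemeasurable (by fun_prop))
    (L.continuous.measurable.comp_aemeasurable hX)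
    (map_sum_mul_gaussianSeq fun k ↦ L (x k)) hsq.hasSum.tendsto_sum_nat ?_
  filter_upwards [ae_summable_smul_gaussianSeq hx] with ω hω
  simpa using (hω.hasSum.mapL L).tendsto_sum_nat

end GaussianSeries

lemma isCenteredGaussian_map_smul {E : Type*} [NormedAddCommGroup E] [NormedSpace ℝ E]
    [MeasurableSpace E] [BorelSpace E] (x : E) :
    IsCenteredGaussian ((gaussianReal 0 1).map fun t : ℝ ↦ t • x) := by
  have hx : Measurable fun t : ℝ ↦ t • x := by fun_prop
  refine ⟨Measure.isProbabilityMeasure_map hx.aemeasurable, fun L ↦ ?_⟩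
  rw [Measure.map_map L.continuous.measurable hx]
  have : (L ∘ fun t : ℝ ↦ t • x) = fun t ↦ t * L x := by ext; simp
  rw [this, gaussianReal_map_mul_const, mul_zero]
  exact ⟨_, rfl⟩

/-- The sign change of one coordinate of a sequence. -/
def negCoord (n : ℕ) (ω : ℕ → ℝ) : ℕ → ℝ := fun k ↦ if k = n then -ω k else ω k

lemma measurePreserving_negCoord (n : ℕ) :
    MeasurePreserving (negCoord n) gaussianSeq gaussianSeq := by
  have hf (k : ℕ) : Measurable fun t : ℝ ↦ if k = n then -t else t := by
    split_ifs <;> fun_prop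
  refine ⟨measurable_pi_lambda _ fun k ↦ (hf k).comp (measurable_pi_apply k), ?_⟩
  refine (Measure.infinitePi_map_pi _ hf).trans ?_
  congr 1
  ext1 k
  split_ifs
  · simpa using gaussianReal_map_neg (μ := 0) (v := 1)
  · exact Measure.map_id'

lemma exists_pos_gaussianReal_closedBall_lt {ε : ℝ≥0∞} (hε : 0 < ε) :
    ∃ δ > 0, gaussianReal 0 1 (Metric.closedBall 0 δ) < ε := by
  have h0 : gaussianReal 0 1 {0} = 0 :=
    gaussianReal_absolutelyContinuous 0 one_ne_zero Real.volume_singleton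
  obtain ⟨U, hU, hUo, hUε⟩ := Set.exists_isOpen_lt_of_lt (μ := gaussianReal 0 1) {0} ε (h0 ▸ hε)
  obtain ⟨δ, hδ, hδU⟩ := Metric.nhds_basis_closedBall.mem_iff.1
    (hUo.mem_nhds (Set.singleton_subset_iff.1 hU))
  exact ⟨δ, hδ, (measure_mono hδU).trans_lt hUε⟩

section NormSublevel

variable {E F : Type*} [NormedAddCommGroup F] [MeasurableSpace E] [MeasurableSpace F]
  [BorelSpace F] {μ : Measure E} [IsProbabilityMeasure μ] {f : E → F}

/-- A null-measurable map is bounded on a measurable set of nearly full probability. -/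
lemma exists_measurableSet_norm_le_of_nullMeasurable (hf : NullMeasurable f μ) {c : ℝ≥0∞}
    (hc : c < 1) : ∃ (M : ℝ) (B : Set E), MeasurableSet B ∧ (∀ y ∈ B, ‖f y‖ ≤ M) ∧ c < μ B := by
  let A (n : ℕ) : Set E := {y | ‖f y‖ ≤ n}
  have hA (n : ℕ) : NullMeasurableSet (A n) μ :=
    hf (measurableSet_le measurable_norm measurable_const)
  have hmono : Monotone A := fun m n hmn y (hy : ‖f y‖ ≤ m) ↦
    (hy.trans (Nat.cast_le.2 hmn) : ‖f y‖ ≤ n)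
  have hU : ⋃ n, A n = Set.univ :=
    Set.eq_univ_of_forall fun y ↦ Set.mem_iUnion.2 (exists_nat_ge ‖f y‖)
  have hlim := tendsto_measure_iUnion_atTop (μ := μ) hmono
  rw [hU, measure_univ] at hlim
  obtain ⟨n, hn⟩ := (hlim.eventually_const_lt hc).exists
  obtain ⟨B, hBA, hB, hBeq⟩ := (hA n).exists_measurable_subset_ae_eq
  exact ⟨n, B, hB, fun y hy ↦ hBA hy, (measure_congr hBeq).symm ▸ hn⟩

end NormSublevel

/-- An additive map from the line that is bounded near the origin is continuous. -/
lemma continuous_of_norm_le_nhds_zero {F : Type*} [NormedAddCommGroup F]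
    [NormedSpace ℝ F] (f : ℝ →+ F) {C : ℝ} (h : ∀ᶠ t in 𝓝 0, ‖f t‖ ≤ C) :
    Continuous f := by
  refine continuous_of_continuousAt_zero f ?_
  rw [ContinuousAt, map_zero, Metric.tendsto_nhds]
  intro ε hε
  obtain ⟨n, hn⟩ := exists_nat_gt (C / ε)
  have hlim : Tendsto (fun t : ℝ ↦ (n + 1) * t) (𝓝 0) (𝓝 0) := by
    simpa using (continuous_const_mul ((n : ℝ) + 1)).tendsto 0
  filter_upwards [hlim.eventually h] with t ht
  have : f ((n + 1) * t) = ((n : ℝ) + 1) • f t := by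
    have := map_nsmul f (n + 1) t
    rw [← Nat.cast_smul_eq_nsmul ℝ, ← Nat.cast_smul_eq_nsmul ℝ, smul_eq_mul] at this
    exact_mod_cast this
  rw [this, norm_smul, Real.norm_of_nonneg (by positivity)] at ht
  rw [dist_zero_right]
  rw [div_lt_iff₀ hε] at hn
  by_contra! hle
  nlinarith [mul_le_mul_of_nonneg_left hle (Nat.cast_nonneg (α := ℝ) n)]

section Additive

variable {E F : Type*} [NormedAddCommGroup E] [NormedSpace ℝ E] [MeasurableSpace E] [BorelSpace E]
  [NormedAddCommGroup F] [NormedSpace ℝ F] [MeasurableSpace F] [BorelSpace F]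

variable (ψ : E →+ F) (hmeas : ∀ μ : Measure E, IsCenteredGaussian μ → NullMeasurable ψ μ)
include hmeas

lemma map_real_smul_of_nullMeasurable (t : ℝ) (x : E) : ψ (t • x) = t • ψ x := by
  have hx : Measurable fun t : ℝ ↦ t • x := by fun_prop
  have hμ := isCenteredGaussian_map_smul x
  have := hμ.1
  obtain ⟨M, B, hB, hBM, hpos⟩ :=
    exists_measurableSet_norm_le_of_nullMeasurable (hmeas _ hμ) zero_lt_one
  rw [Measure.map_apply hx hB] at hpos
  have hvol : 0 < volume ((fun t : ℝ ↦ t • x) ⁻¹' B) := by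
    refine pos_iff_ne_zero.2 fun h ↦ hpos.ne' ?_
    exact gaussianReal_absolutelyContinuous 0 one_ne_zero h
  have hst := Measure.sub_mem_nhds_zero_of_addHaar_pos volume _ (hx hB) hvol
  let f : ℝ →+ F := ψ.comp (LinearMap.toSpanSingleton ℝ E x).toAddMonoidHom
  have hf : Continuous f := by
    refine continuous_of_norm_le_nhds_zero f (C := M + M) ?_
    filter_upwards [hst]
    rintro _ ⟨a, ha, b, hb, rfl⟩
    rw [map_sub]
    exact (norm_sub_le _ _).trans (add_le_add (hBM _ ha) (hBM _ hb))
  simpa [f] using map_real_smul f hf t 1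

lemma exists_norm_le_of_nullMeasurable [CompleteSpace E] {x : ℕ → E}
    (hx : Summable fun k ↦ ‖x k‖) : ∃ C, ∀ n, ‖ψ (x n)‖ ≤ C := by
  have hX := aemeasurable_tsum_smul_gaussianSeq hx
  have hμ := isCenteredGaussian_map_tsum_smul hx
  have := hμ.1
  obtain ⟨M, B, hB, hBM, hBc⟩ := exists_measurableSet_norm_le_of_nullMeasurable
    (hmeas _ hμ) (c := 1 - 3⁻¹) (ENNReal.sub_lt_self (by simp) (by simp) (by simp))
  obtain ⟨δ, hδ, hδ3⟩ := exists_pos_gaussianReal_closedBall_lt (ε := 3⁻¹) (by simp)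
  refine ⟨M / δ, fun n ↦ ?_⟩
  set X : (ℕ → ℝ) → E := fun ω ↦ ∑' k, ω k • x k with hXdef
  have hBn : gaussianSeq {ω | X ω ∉ B} < 3⁻¹ := by
    have h : gaussianSeq.map X Bᶜ < 3⁻¹ := by
      rw [prob_compl_eq_one_sub hB]
      exact ENNReal.sub_lt_of_sub_lt prob_le_one (by simp) hBc
    rwa [Measure.map_apply_of_aemeasurable hX hB.compl] at h
  have hsymm : gaussianSeq {ω | X (negCoord n ω) ∉ B} < 3⁻¹ :=
    ((measurePreserving_negCoord n).measure_preimage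
      (hX.nullMeasurableSet_preimage hB.compl)).trans_lt hBn
  have hcoord : gaussianSeq {ω | |ω n| ≤ δ} < 3⁻¹ := by
    rw [← Measure.infinitePi_map_eval (fun _ : ℕ ↦ gaussianReal 0 1) n,
      Measure.map_apply (by fun_prop) Metric.isClosed_closedBall.measurableSet] at hδ3
    simpa [Set.preimage] using hδ3
  have hex : ∃ ω : ℕ → ℝ, (Summable fun k ↦ ω k • x k) ∧ X ω ∈ B ∧ X (negCoord n ω) ∈ B ∧
      δ < |ω n| := by
    by_contra! h
    have hsub : {ω : ℕ → ℝ | Summable fun k ↦ ω k • x k} ⊆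
        {ω | X ω ∉ B} ∪ {ω | X (negCoord n ω) ∉ B} ∪ {ω | |ω n| ≤ δ} := by
      intro ω hω
      by_cases h₁ : X ω ∈ B
      · by_cases h₂ : X (negCoord n ω) ∈ B
        · exact .inr (h ω hω h₁ h₂)
        · exact .inl (.inr h₂)
      · exact .inl (.inl h₁)
    have hone := ((measure_congr (eventuallyEq_univ.2 (ae_summable_smul_gaussianSeq hx))).trans
      measure_univ).symm.trans_le
      ((measure_mono hsub).trans ((measure_union_le _ _).trans
        (add_le_add (measure_union_le _ _) le_rfl)))
    refine hone.not_gt ((ENNReal.add_lt_add (ENNReal.add_lt_add hBn hsymm) hcoord).trans_eq ?_)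
    simpa using ENNReal.add_thirds 1
  obtain ⟨ω, hω, h₁, h₂, hωn⟩ := hex
  have hdiff : X ω - X (negCoord n ω) = (2 * ω n) • x n := by
    have hneg (k : ℕ) : negCoord n ω k • x k =
        ω k • x k - if k = n then (2 * ω n) • x n else 0 := by
      unfold negCoord
      split_ifs with hk
      · subst hk
        module
      · simp
    have hsingle := hasSum_ite_eq n ((2 * ω n) • x n)
    simp only [hXdef, hneg]
    rw [hω.tsum_sub hsingle.summable, hsingle.tsum_eq, sub_sub_cancel]
  have h := (norm_sub_le _ _).trans (add_le_add (hBM _ h₁) (hBM _ h₂))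
  rw [← map_sub, hdiff, map_real_smul_of_nullMeasurable ψ hmeas, norm_smul, norm_mul,
    Real.norm_two, Real.norm_eq_abs] at h
  rw [le_div_iff₀ hδ]
  nlinarith [norm_nonneg (ψ (x n))]

lemma continuous_of_nullMeasurable [CompleteSpace E] : Continuous ψ := by
  have hsmul := map_real_smul_of_nullMeasurable ψ hmeas
  by_contra hcont
  have hunb (n : ℕ) : ∃ y, (n * 2 ^ n : ℝ) * ‖y‖ < ‖ψ y‖ := by
    by_contra! h
    exact hcont (AddMonoidHomClass.continuous_of_bound ψ _ h)
  choose y hy using hunb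
  have hy0 (n : ℕ) : 0 < ‖y n‖ := norm_pos_iff.2 fun h ↦ by simpa [h] using hy n
  let x (n : ℕ) : E := ((2 ^ n)⁻¹ * ‖y n‖⁻¹ : ℝ) • y n
  have hx (n : ℕ) : ‖x n‖ = (1 / 2) ^ n := by
    simp [x, norm_smul, (hy0 n).ne']
  obtain ⟨C, hC⟩ := exists_norm_le_of_nullMeasurable ψ hmeas (x := x)
    (by simpa only [hx] using summable_geometric_two)
  obtain ⟨n, hn⟩ := exists_nat_ge C
  have h := (hC n).trans hn
  rw [hsmul, norm_smul, norm_mul, norm_inv, norm_inv, norm_norm, norm_pow, Real.norm_two,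
    ← mul_inv, inv_mul_le_iff₀ (by have := hy0 n; positivity)] at h
  nlinarith [hy n]

end Additive

theorem stroock_theorem
    {E F : Type*}
    [NormedAddCommGroup E] [NormedSpace ℝ E] [CompleteSpace E]
    [NormedAddCommGroup F] [NormedSpace ℝ F] [CompleteSpace F]
    [MeasurableSpace E] [BorelSpace E] [MeasurableSpace F] [BorelSpace F]
    (ψ : E → F) (hadd : ∀ x y : E, ψ (x + y) = ψ x + ψ y)
    (hmeas : ∀ μ : Measure E, IsCenteredGaussian μ → NullMeasurable ψ μ) :
    Continuous ψ ∧ IsLinearMap ℝ ψ := by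
  have hcont : Continuous (AddMonoidHom.mk' ψ hadd) :=
    continuous_of_nullMeasurable (AddMonoidHom.mk' ψ hadd) hmeas
  exact ⟨hcont, hadd, map_real_smul_of_nullMeasurable (AddMonoidHom.mk' ψ hadd) hmeas⟩
end

section
/- Let E and F be real Banach spaces, let ψ : E → F be an additive map, and fix x ∈ E and y* ∈ F*. Let μ_x denote the image on E of the standard normal distribution on ℝ under the map t ↦ t•x. If ψ is μ_x-measurable, then ⟨ψ(t•x), y*⟩ = t·⟨ψ(x), y*⟩ for every real t. -/
open MeasureTheory ProbabilityTheory

open scoped Topology Pointwise in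
/-- A Lebesgue measurable additive map from `ℝ` to a real normed space is continuous. -/
lemma AddMonoidHom.continuous_of_nullMeasurable {H : Type*} [SeminormedAddCommGroup H]
    [NormedSpace ℝ H] [MeasurableSpace H] [OpensMeasurableSpace H] (f : ℝ →+ H)
    (hf : NullMeasurable f (volume : Measure ℝ)) : Continuous f := by
  obtain ⟨n, hn⟩ : ∃ n : ℕ, 0 < volume (Set.Icc (0 : ℝ) 1 ∩ f ⁻¹' Metric.ball 0 n) := by
    by_contra! h
    simp_rw [nonpos_iff_eq_zero, ← measure_iUnion_null_iff, ← Set.inter_iUnion,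
      ← Set.preimage_iUnion, Metric.iUnion_ball_nat, Set.preimage_univ, Set.inter_univ] at h
    simp at h
  obtain ⟨s, hsub, hs, hae⟩ := (measurableSet_Icc.nullMeasurableSet.inter
    (hf Metric.isOpen_ball.measurableSet)).exists_measurable_subset_ae_eq
  have hpos : 0 < volume s := by rwa [measure_congr hae]
  have hfin : volume s ≠ ⊤ :=
    measure_ne_top_of_subset (hsub.trans Set.inter_subset_left) (by simp)
  refine f.continuous_of_isBounded_nhds_zero
    (Measure.sub_mem_nhds_zero_of_addHaar_pos_ne_top volume s hs hpos hfin) ?_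
  have hb : Bornology.IsBounded (f '' s) :=
    Metric.isBounded_ball.subset <| (Set.image_mono (hsub.trans Set.inter_subset_right)).trans <|
      Set.image_preimage_subset _ _
  rw [Set.image_sub]
  exact hb.sub hb

theorem pairing_linear_of_gaussian_measurable
    {E F : Type*}
    [NormedAddCommGroup E] [NormedSpace ℝ E] [CompleteSpace E]
    [NormedAddCommGroup F] [NormedSpace ℝ F] [CompleteSpace F]
    [MeasurableSpace E] [BorelSpace E] [MeasurableSpace F] [BorelSpace F]
    (ψ : E → F) (hadd : ∀ x y : E, ψ (x + y) = ψ x + ψ y)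
    (x : E) (ystar : F →L[ℝ] ℝ)
    (hmeas : NullMeasurable ψ ((gaussianReal 0 1).map (fun t : ℝ => t • x))) :
    ∀ t : ℝ, ystar (ψ (t • x)) = t * ystar (ψ x) := by
  have hf : NullMeasurable (fun t : ℝ => ystar (ψ (t • x))) volume := by
    have h : NullMeasurable (fun t : ℝ => ystar (ψ (t • x))) (gaussianReal 0 1) :=
      (ystar.continuous.measurable.comp_nullMeasurable hmeas).comp_quasiMeasurePreserving
        ((measurable_id.smul_const x).quasiMeasurePreserving _)
    exact fun s hs => (h hs).mono_ac (gaussianReal_absolutelyContinuous' 0 one_ne_zero)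
  let f : ℝ →+ ℝ := AddMonoidHom.mk' (fun t => ystar (ψ (t • x)))
    fun a b => by simp [add_smul, hadd]
  intro t
  simpa [f] using map_real_smul f (f.continuous_of_nullMeasurable hf) t 1
end

section
/- Let E and F be real Banach spaces and let ψ : E → F be an additive map that is μ-measurable for every centered Gaussian measure μ on E. Then for every centered Gaussian measure μ on E, the image measure ψ∗μ is a centered Gaussian measure on F. -/
open MeasureTheory ProbabilityTheory

open Filter Topology Measure

/-- An additive function on `ℝ` that is Lebesgue measurable is continuous. -/
lemma AddMonoidHom.continuous_of_nullMeasurable_s6 (f : ℝ →+ ℝ) (hf : NullMeasurable f volume) :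
    Continuous f := by
  obtain ⟨n, hn⟩ : ∃ n : ℕ, 0 < volume (f ⁻¹' Metric.ball 0 n) := by
    by_contra! h
    simp_rw [nonpos_iff_eq_zero, ← measure_iUnion_null_iff, ← Set.preimage_iUnion,
      Metric.iUnion_ball_nat, Set.preimage_univ] at h
    simp at h
  obtain ⟨s, hs, hsm, hsae⟩ := (hf Metric.isOpen_ball.measurableSet).exists_measurable_subset_ae_eq
  refine f.continuous_of_isBounded_nhds_zero
    (sub_mem_nhds_zero_of_addHaar_pos volume s hsm (by rwa [measure_congr hsae])) ?_
  have hb : Bornology.IsBounded (f '' s) :=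
    Metric.isBounded_ball.subset <| (Set.image_mono hs).trans <| Set.image_preimage_subset _ _
  rw [Set.image_sub]
  exact hb.sub hb

section

variable {E : Type*} [NormedAddCommGroup E] [NormedSpace ℝ E]

/-- The law of a sequence of independent standard normal random variables. -/
noncomputable def stdGaussianSeq : Measure (ℕ → ℝ) := infinitePi fun _ ↦ gaussianReal 0 1

instance : IsProbabilityMeasure stdGaussianSeq := by unfold stdGaussianSeq; infer_instance

lemma measurePreserving_eval_stdGaussianSeq (n : ℕ) :
    MeasurePreserving (fun g : ℕ → ℝ ↦ g n) stdGaussianSeq (gaussianReal 0 1) :=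
  measurePreserving_eval_infinitePi _ n

/-- Changing the sign of one coordinate. -/
def flipCoord (n : ℕ) (g : ℕ → ℝ) : ℕ → ℝ := fun i ↦ if i = n then -g i else g i

lemma measurePreserving_flipCoord (n : ℕ) :
    MeasurePreserving (flipCoord n) stdGaussianSeq stdGaussianSeq := by
  have hm (i : ℕ) : Measurable fun t : ℝ ↦ if i = n then -t else t := by
    split_ifs <;> fun_prop
  refine ⟨measurable_pi_lambda _ fun i ↦ (hm i).comp (measurable_pi_apply i), ?_⟩
  unfold stdGaussianSeq flipCoord
  rw [infinitePi_map_pi (f := fun i t ↦ if i = n then -t else t) _ hm]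
  congr! with i
  split_ifs
  · simpa using gaussianReal_map_neg (μ := 0) (v := 1)
  · simp

lemma ae_summable_norm_smul {x : ℕ → E} (hx : Summable fun n ↦ ‖x n‖) :
    ∀ᵐ g ∂stdGaussianSeq, Summable fun n ↦ ‖g n • x n‖ := by
  have hC : ∫⁻ t, ‖t‖ₑ ∂gaussianReal 0 1 < ⊤ :=
    (IsGaussian.integrable_id (μ := gaussianReal 0 1)).2
  have hm (n : ℕ) : Measurable fun g : ℕ → ℝ ↦ ‖g n • x n‖ₑ := by
    simp only [enorm_smul]
    fun_prop
  have h (n : ℕ) : ∫⁻ g, ‖g n • x n‖ₑ ∂stdGaussianSeq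
      = (∫⁻ t, ‖t‖ₑ ∂gaussianReal 0 1) * ‖x n‖ₑ := by
    simp only [enorm_smul]
    rw [lintegral_mul_const _ (by fun_prop)]
    congr 1
    exact (measurePreserving_eval_stdGaussianSeq n).lintegral_comp measurable_enorm
  have hfin : ∫⁻ g, ∑' n, ‖g n • x n‖ₑ ∂stdGaussianSeq ≠ ⊤ := by
    rw [lintegral_tsum fun n ↦ (hm n).aemeasurable]
    simp_rw [h, ENNReal.tsum_mul_left]
    refine ENNReal.mul_ne_top hC.ne ?_
    simpa using! hx.tsum_ofReal_ne_top
  filter_upwards [ae_lt_top (Measurable.tsum hm) hfin] with g hg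
  have := ENNReal.summable_toReal hg.ne
  simpa using this

lemma map_tsum_eq_gaussianReal {a : ℕ → ℝ} (ha : Summable fun n ↦ ‖a n‖) :
    stdGaussianSeq.map (fun g ↦ ∑' n, g n * a n)
      = gaussianReal 0 (.mk (∑' n, a n ^ 2) (tsum_nonneg fun _ ↦ sq_nonneg _)) := by
  have hm : Measurable fun g : ℕ → ℝ ↦ ∑' n, g n * a n := Measurable.tsum fun n ↦ by fun_prop
  have : IsProbabilityMeasure (stdGaussianSeq.map fun g ↦ ∑' n, g n * a n) :=
    isProbabilityMeasure_map hm.aemeasurable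
  have ha2 : Summable fun n ↦ a n ^ 2 := by
    have h := ha.mul_of_nonneg ha (fun _ ↦ norm_nonneg _) (fun _ ↦ norm_nonneg _)
    simpa [Function.comp_def, ← sq] using h.comp_injective (i := fun n : ℕ ↦ (n, n))
      fun _ _ h ↦ (Prod.ext_iff.1 h).1
  apply Measure.ext_of_charFun
  ext t
  have hfin (N : ℕ) : ∫ g, Complex.exp (t * (∑ n ∈ Finset.range N, g n * a n : ℝ) * Complex.I)
      ∂stdGaussianSeq = Complex.exp (- (∑ n ∈ Finset.range N, a n ^ 2 : ℝ) * t ^ 2 / 2) := by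
    have hind : iIndepFun (fun n (g : ℕ → ℝ) ↦ g n * a n) stdGaussianSeq :=
      iIndepFun_infinitePi (X := fun n t ↦ t * a n) fun n ↦ by fun_prop
    have h := congrFun (iIndepFun.charFun_map_fun_finsetSum_eq_prod (s := Finset.range N)
      (X := fun n (g : ℕ → ℝ) ↦ g n * a n) (fun i _ ↦ (by fun_prop : Measurable _).aemeasurable)
      (hind.restrict _)) t
    rw [charFun_apply_real, integral_map (by fun_prop : Measurable _).aemeasurable (by fun_prop)] at h
    rw [h]
    have h1 (n : ℕ) : charFun (stdGaussianSeq.map fun g ↦ g n * a n) t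
        = Complex.exp (-(a n ^ 2 * t ^ 2 / 2)) := by
      have : stdGaussianSeq.map (fun g ↦ g n * a n) = (gaussianReal 0 1).map (· * a n) := by
        rw [← (measurePreserving_eval_stdGaussianSeq n).map_eq, map_map (by fun_prop) (by fun_prop)]
        rfl
      rw [this, gaussianReal_map_mul_const, charFun_gaussianReal]
      simp
    simp only [Finset.prod_apply, h1, ← Complex.exp_sum]
    congr 1
    push_cast
    rw [Finset.sum_neg_distrib, neg_mul, neg_div, Finset.sum_mul, Finset.sum_div]
  rw [charFun_apply_real, integral_map hm.aemeasurable (by fun_prop), charFun_gaussianReal]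
  have hl : Tendsto (fun N ↦ ∫ g, Complex.exp
      (t * (∑ n ∈ Finset.range N, g n * a n : ℝ) * Complex.I) ∂stdGaussianSeq) atTop
      (𝓝 (∫ g, Complex.exp (t * (∑' n, g n * a n : ℝ) * Complex.I) ∂stdGaussianSeq)) := by
    refine tendsto_integral_of_dominated_convergence (fun _ ↦ 1)
      (fun N ↦ (by fun_prop : Measurable _).aestronglyMeasurable)
      (integrable_const _) (fun N ↦ .of_forall fun g ↦ ?_) ?_
    · rw [← Complex.ofReal_mul, Complex.norm_exp_ofReal_mul_I]
    · filter_upwards [ae_summable_norm_smul ha] with g hg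
      have := hg.of_norm.hasSum.tendsto_sum_nat
      simp only [smul_eq_mul] at this
      exact ((by fun_prop : Continuous fun y : ℝ ↦
        Complex.exp (t * (y : ℂ) * Complex.I)).tendsto _).comp this
  refine tendsto_nhds_unique hl ?_
  simp_rw [hfin]
  have hc : Continuous fun y : ℝ ↦ Complex.exp (-(y : ℂ) * t ^ 2 / 2) := by fun_prop
  have hv : Complex.exp (t * (0 : ℝ) * Complex.I - (∑' n, a n ^ 2 : ℝ) * t ^ 2 / 2)
      = Complex.exp (-(∑' n, a n ^ 2 : ℝ) * t ^ 2 / 2) := by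
    congr 1
    simp only [Complex.ofReal_zero]
    ring
  exact ((hc.tendsto _).comp ha2.hasSum.tendsto_sum_nat).trans_eq (congrArg 𝓝 hv.symm)

lemma tsum_smul_sub_tsum_flipCoord_smul [CompleteSpace E] {x : ℕ → E} {g : ℕ → ℝ}
    (hg : Summable fun n ↦ ‖g n • x n‖) (n : ℕ) :
    ∑' i, g i • x i - ∑' i, flipCoord n g i • x i = (2 * g n) • x n := by
  have hg' : Summable fun i ↦ ‖flipCoord n g i • x i‖ := by
    convert hg using 2 with i
    unfold flipCoord
    split_ifs <;> simp
  rw [← hg.of_norm.tsum_sub hg'.of_norm, tsum_eq_single n fun i hi ↦ by simp [flipCoord, hi]]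
  simp [flipCoord, two_mul, add_smul]

variable [MeasurableSpace E] [BorelSpace E]

lemma isCenteredGaussian_map_smul_const (x : E) :
    IsCenteredGaussian ((gaussianReal 0 1).map fun t : ℝ ↦ t • x) := by
  have hm : Measurable fun t : ℝ ↦ t • x := (by fun_prop : Continuous fun t : ℝ ↦ t • x).measurable
  refine ⟨isProbabilityMeasure_map hm.aemeasurable, fun L ↦ ⟨.mk (L x ^ 2) (sq_nonneg _) * 1, ?_⟩⟩
  rw [map_map L.continuous.measurable hm]
  simpa [Function.comp_def] using gaussianReal_map_mul_const (μ := 0) (v := 1) (L x)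

lemma aemeasurable_tsum_smul [CompleteSpace E] {x : ℕ → E} (hx : Summable fun n ↦ ‖x n‖) :
    AEMeasurable (fun g ↦ ∑' n, g n • x n) stdGaussianSeq := by
  refine AEStronglyMeasurable.aemeasurable <| aestronglyMeasurable_of_tendsto_ae atTop
    (f := fun N g ↦ ∑ n ∈ Finset.range N, g n • x n) (fun N ↦ ?_) ?_
  · refine Finset.aestronglyMeasurable_fun_sum _ fun n _ ↦ ?_
    exact ((measurable_pi_apply n).stronglyMeasurable.smul_const (x n)).aestronglyMeasurable
  · filter_upwards [ae_summable_norm_smul hx] with g hg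
    exact hg.of_norm.hasSum.tendsto_sum_nat

lemma isCenteredGaussian_map_tsum_smul_s6 [CompleteSpace E] {x : ℕ → E}
    (hx : Summable fun n ↦ ‖x n‖) :
    IsCenteredGaussian (stdGaussianSeq.map fun g ↦ ∑' n, g n • x n) := by
  have hm := aemeasurable_tsum_smul hx
  refine ⟨isProbabilityMeasure_map hm, fun L ↦ ?_⟩
  have ha : Summable fun n ↦ ‖L (x n)‖ :=
    .of_nonneg_of_le (fun _ ↦ norm_nonneg _) (fun n ↦ L.le_opNorm (x n)) (hx.mul_left ‖L‖)
  refine ⟨_, Eq.trans ?_ (map_tsum_eq_gaussianReal ha)⟩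
  rw [AEMeasurable.map_map_of_aemeasurable L.continuous.measurable.aemeasurable hm]
  refine Measure.map_congr ?_
  filter_upwards [ae_summable_norm_smul hx] with g hg
  simp [L.map_tsum hg.of_norm]

/-- A real-valued linear form which is measurable for all centered Gaussian measures is
continuous. -/
lemma LinearMap.continuous_of_nullMeasurable_gaussian [CompleteSpace E] (f : E →ₗ[ℝ] ℝ)
    (hf : ∀ μ : Measure E, IsCenteredGaussian μ → NullMeasurable f μ) : Continuous f := by
  by_contra hcont
  have hbig (n : ℕ) : ∃ y : E, ‖y‖ ≤ (1 / 2) ^ n ∧ (n : ℝ) < |f y| := by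
    by_contra! h
    refine hcont (AddMonoidHomClass.continuous_of_bound f (n * 2 ^ n) fun y ↦ ?_)
    rcases eq_or_ne y 0 with rfl | hy
    · simp
    have hy' : 0 < ‖y‖ := norm_pos_iff.2 hy
    have := h (((1 / 2) ^ n * ‖y‖⁻¹) • y) (by
      rw [norm_smul, norm_mul, norm_inv, norm_norm, mul_assoc, inv_mul_cancel₀ hy'.ne']
      simp)
    rw [map_smul, smul_eq_mul, abs_mul, abs_of_pos (by positivity)] at this
    rw [Real.norm_eq_abs]
    calc |f y| = ((1 / 2) ^ n * ‖y‖⁻¹ * |f y|) * (2 ^ n * ‖y‖) := by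
          rw [one_div, inv_pow]; field_simp
      _ ≤ n * (2 ^ n * ‖y‖) := by gcongr
      _ = _ := by ring
  choose x hx hfx using hbig
  have hsum : Summable fun n ↦ ‖x n‖ :=
    .of_nonneg_of_le (fun _ ↦ norm_nonneg _) hx summable_geometric_two
  set T : (ℕ → ℝ) → E := fun g ↦ ∑' n, g n • x n
  have hTm : AEMeasurable T stdGaussianSeq := aemeasurable_tsum_smul hsum
  have hFm : NullMeasurable (f ∘ T) stdGaussianSeq := by
    refine NullMeasurable.congr (f := f ∘ hTm.mk T) (fun s hs ↦ ?_)
      (hTm.ae_eq_mk.symm.fun_comp f)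
    refine (hf _ ?_ hs).preimage (hTm.measurable_mk.quasiMeasurePreserving _)
    rw [← Measure.map_congr hTm.ae_eq_mk]
    exact isCenteredGaussian_map_tsum_smul_s6 hsum
  obtain ⟨M, hM⟩ : ∃ M : ℕ, stdGaussianSeq {g | (M : ℝ) < |f (T g)|} < 1 / 4 := by
    have h := tendsto_measure_iInter_atTop (μ := stdGaussianSeq)
      (s := fun M : ℕ ↦ {g | (M : ℝ) < |f (T g)|})
      (fun M ↦ hFm (measurableSet_lt measurable_const measurable_id.abs))
      (fun M N hMN g (hg : (N : ℝ) < _) ↦ (Nat.cast_le.2 hMN).trans_lt hg)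
      ⟨0, measure_ne_top _ _⟩
    have h0 : ⋂ M : ℕ, {g | (M : ℝ) < |f (T g)|} = ∅ := by
      refine Set.eq_empty_of_forall_notMem fun g hg ↦ ?_
      obtain ⟨M, hM⟩ := exists_nat_ge |f (T g)|
      exact hM.not_gt (Set.mem_iInter.1 hg M)
    rw [h0, measure_empty] at h
    exact (h.eventually_lt_const (by simp)).exists
  have hsmall : Tendsto (fun n : ℕ ↦ gaussianReal 0 1 {t | |t| * n ≤ M}) atTop (𝓝 0) := by
    have h := tendsto_measure_iInter_atTop (μ := gaussianReal 0 1)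
      (s := fun n : ℕ ↦ {t | |t| * n ≤ M})
      (fun n ↦ (measurableSet_le (by fun_prop) measurable_const).nullMeasurableSet)
      (fun n m hnm t (ht : |t| * m ≤ M) ↦ (by gcongr : |t| * n ≤ |t| * m).trans ht)
      ⟨0, measure_ne_top _ _⟩
    have h0 : ⋂ n : ℕ, {t : ℝ | |t| * n ≤ M} ⊆ {0} := fun t ht ↦ by
      by_contra ht0
      obtain ⟨n, hn⟩ := exists_nat_gt (M / |t|)
      rw [div_lt_iff₀' (abs_pos.2 ht0)] at hn
      exact hn.not_ge (Set.mem_iInter.1 ht n)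
    have := nullSingletonClass_gaussianReal (μ := 0) one_ne_zero
    rwa [measure_mono_null h0 (measure_singleton 0)] at h
  obtain ⟨n, hn⟩ := (hsmall.eventually_lt_const (by simp : (0 : ENNReal) < 1 / 4)).exists
  set A := {g | (M : ℝ) < |f (T g)|} with hA
  have hflip : stdGaussianSeq (flipCoord n ⁻¹' A) = stdGaussianSeq A :=
    (measurePreserving_flipCoord n).measure_preimage
      (hFm (measurableSet_lt measurable_const measurable_id.abs))
  have heval : stdGaussianSeq {g | |g n| * n ≤ M} = gaussianReal 0 1 {t | |t| * n ≤ M} :=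
    (measurePreserving_eval_stdGaussianSeq n).measure_preimage
      (measurableSet_le (f := fun t : ℝ ↦ |t| * n) (by fun_prop) measurable_const).nullMeasurableSet
  have hcover : ∀ᵐ g ∂stdGaussianSeq, g ∈ {g : ℕ → ℝ | |g n| * n ≤ M} ∪ (A ∪ flipCoord n ⁻¹' A) := by
    filter_upwards [ae_summable_norm_smul hsum] with g hg
    by_contra! h
    simp only [Set.mem_union, Set.mem_ofPred_eq, Set.mem_preimage, hA, not_or, not_le, not_lt] at h
    obtain ⟨h1, h2, h3⟩ := h
    have h4 := congrArg f (tsum_smul_sub_tsum_flipCoord_smul hg n)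
    rw [map_sub, map_smul, smul_eq_mul] at h4
    have h5 := abs_sub (f (T g)) (f (T (flipCoord n g)))
    rw [h4, abs_mul, abs_mul, abs_two] at h5
    have h6 : |g n| * n ≤ |g n| * |f (x n)| := by gcongr; exact (hfx n).le
    linarith
  have hlt : stdGaussianSeq ({g : ℕ → ℝ | |g n| * n ≤ M} ∪ (A ∪ flipCoord n ⁻¹' A)) < 1 := by
    calc _ ≤ stdGaussianSeq {g | |g n| * n ≤ M} + (stdGaussianSeq A +
          stdGaussianSeq (flipCoord n ⁻¹' A)) :=
          (measure_union_le _ _).trans (by gcongr; exact measure_union_le _ _)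
      _ < 1 / 4 + (1 / 4 + 1 / 4) := by
          rw [hflip, heval]
          exact ENNReal.add_lt_add hn (ENNReal.add_lt_add hM hM)
      _ ≤ 1 := by
          rw [← ENNReal.toReal_le_toReal (by simp) (by simp)]
          norm_num [ENNReal.toReal_add]
  exact hlt.ne ((measure_congr (eventuallyEq_univ.2 hcover)).trans measure_univ)

end

theorem pushforward_of_centered_gaussian_is_centered_gaussian
    {E F : Type*}
    [NormedAddCommGroup E] [NormedSpace ℝ E] [CompleteSpace E]
    [NormedAddCommGroup F] [NormedSpace ℝ F] [CompleteSpace F]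
    [MeasurableSpace E] [BorelSpace E] [MeasurableSpace F] [BorelSpace F]
    (ψ : E → F) (hadd : ∀ x y : E, ψ (x + y) = ψ x + ψ y)
    (hmeas : ∀ μ : Measure E, IsCenteredGaussian μ → NullMeasurable ψ μ) :
    ∀ μ : Measure E, IsCenteredGaussian μ → IsCenteredGaussian (μ.map ψ) := by
  have hsmul (t : ℝ) (x : E) : ψ (t • x) = t • ψ x := by
    refine SeparatingDual.eq_iff_forall_dual_eq (R := ℝ) |>.2 fun L ↦ ?_
    let h : ℝ →+ ℝ := AddMonoidHom.mk' (fun s ↦ L (ψ (s • x))) fun s s' ↦ by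
      simp [add_smul, hadd]
    have hm : NullMeasurable h volume := fun s hs ↦
      ((hmeas _ (isCenteredGaussian_map_smul_const x)
        (L.continuous.measurable hs)).preimage
          ((by fun_prop : Continuous fun t : ℝ ↦ t • x).measurable.quasiMeasurePreserving _)).mono_ac
        (gaussianReal_absolutelyContinuous' 0 one_ne_zero)
    have := map_real_smul h (h.continuous_of_nullMeasurable_s6 hm) t 1
    simpa [h] using this
  let f : E →ₗ[ℝ] F := { toFun := ψ, map_add' := hadd, map_smul' := hsmul }
  have hL (L : F →L[ℝ] ℝ) : Continuous fun x ↦ L (f x) :=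
    (L.toLinearMap ∘ₗ f).continuous_of_nullMeasurable_gaussian fun μ hμ s hs ↦
      hmeas μ hμ (L.continuous.measurable hs)
  have hf : Continuous f := f.continuous_of_seq_closed_graph fun u x y hu hfu ↦
    SeparatingDual.eq_iff_forall_dual_eq (R := ℝ) |>.2 fun L ↦
      tendsto_nhds_unique ((L.continuous.tendsto y).comp hfu) (((hL L).tendsto x).comp hu)
  rintro μ ⟨hμ, hμL⟩
  have hψ : Measurable ψ := hf.measurable
  refine ⟨isProbabilityMeasure_map hψ.aemeasurable, fun L ↦ ?_⟩
  rw [map_map L.continuous.measurable hψ]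
  exact hμL (L ∘L ⟨f, hf⟩)
end

section
/- Let μ be a Borel probability measure on a real separable Banach space E, and let X and Y be independent E-valued random elements, each with distribution μ. If the random vector ((X+Y)/√2, (X−Y)/√2) has the same distribution as (X, Y), then μ is a centered Gaussian measure on E. -/
open MeasureTheory ProbabilityTheory

/-- A continuous solution of the quadratic functional equation is a multiple of `t ^ 2`. -/
lemma eq_mul_sq_of_quadratic {h : ℝ → ℝ} (hc : Continuous h)
    (hq : ∀ s t, h (s + t) + h (s - t) = 2 * h s + 2 * h t) (t : ℝ) :
    h t = h 1 * t ^ 2 := by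
  have h0 : h 0 = 0 := by
    have := hq 0 0
    simp only [add_zero, sub_zero] at this
    linarith
  have hneg (t : ℝ) : h (-t) = h t := by
    have := hq 0 t
    simp only [zero_add, zero_sub] at this
    linarith
  have hnat (s : ℝ) (n : ℕ) : h (n * s) = n ^ 2 * h s := by
    induction n using Nat.twoStepInduction with
    | zero => simp [h0]
    | one => simp
    | more n ih₀ ih₁ =>
      have := hq ((n + 1 : ℕ) * s) s
      rw [show ((n + 1 : ℕ) : ℝ) * s + s = ((n + 2 : ℕ) : ℝ) * s by push_cast; ring,
        show ((n + 1 : ℕ) : ℝ) * s - s = n * s by push_cast; ring, ih₀, ih₁] at this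
      push_cast at this ⊢
      linarith
  have hint (s : ℝ) (n : ℤ) : h (n * s) = n ^ 2 * h s := by
    obtain ⟨m, rfl | rfl⟩ := n.eq_nat_or_neg
    · exact_mod_cast hnat s m
    · push_cast
      rw [neg_mul, hneg, hnat, neg_sq]
  have hrat (q : ℚ) : h q = h 1 * (q : ℝ) ^ 2 := by
    have hd : (q.den : ℝ) ≠ 0 := by exact_mod_cast q.den_nz
    have hqd : (q.den : ℝ) * q = q.num * 1 := by
      rw [mul_one]; exact_mod_cast Rat.den_mul_eq_num q
    have h₁ := hnat q q.den
    rw [hqd, hint] at h₁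
    have h₂ : (q.num : ℝ) = q.den * q := by rw [hqd, mul_one]
    rw [h₂] at h₁
    have hd2 : (q.den : ℝ) ^ 2 ≠ 0 := pow_ne_zero 2 hd
    apply mul_left_cancel₀ hd2
    linarith
  have hcq : Continuous fun t : ℝ => h 1 * t ^ 2 := by fun_prop
  exact congrFun (Rat.denseRange_cast.equalizer hc hcq (funext hrat)) t

/-- Invariance of `μ.prod μ` under `(x, y) ↦ (c • (x + y), c • (x - y))` gives a functional
equation for the characteristic function of `μ`. -/
lemma charFunDual_mul_charFunDual_of_map_prod_eq {E : Type*} [NormedAddCommGroup E]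
    [NormedSpace ℝ E] [SecondCountableTopology E] [MeasurableSpace E] [BorelSpace E]
    {μ : Measure E} [IsProbabilityMeasure μ] {c : ℝ}
    (hμ : (μ.prod μ).map (fun p => (c • (p.1 + p.2), c • (p.1 - p.2))) = μ.prod μ)
    (A B : StrongDual ℝ E) :
    charFunDual μ A * charFunDual μ B =
      charFunDual μ (c • (A + B)) * charFunDual μ (c • (A - B)) := by
  let R : E × E →L[ℝ] E × E :=
    (c • (ContinuousLinearMap.fst ℝ E E + ContinuousLinearMap.snd ℝ E E)).prod
      (c • (ContinuousLinearMap.fst ℝ E E - ContinuousLinearMap.snd ℝ E E))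
  have hR : (μ.prod μ).map R = μ.prod μ := hμ
  have key := charFunDual_map (μ := μ.prod μ) R (A.coprod B)
  rw [hR, charFunDual_prod, charFunDual_prod] at key
  convert key using 3 <;> ext x <;> simp [R]
  ring

/-- A probability measure on `ℝ` whose characteristic function satisfies the functional equation
of a rotation by `π / 4` is a centered Gaussian. -/
lemma exists_eq_gaussianReal_of_charFun_mul_charFun {ν : Measure ℝ} [IsProbabilityMeasure ν]
    (hν : ∀ s t, charFun ν s * charFun ν t =
      charFun ν ((Real.sqrt 2)⁻¹ * (s + t)) * charFun ν ((Real.sqrt 2)⁻¹ * (s - t))) :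
    ∃ v : NNReal, ν = gaussianReal 0 v := by
  set c : ℝ := (Real.sqrt 2)⁻¹
  have hcs : c * Real.sqrt 2 = 1 := inv_mul_cancel₀ (by positivity)
  have hone : charFun ν 0 = 1 := by simp
  have hnorm (t : ℝ) : charFun ν t = ((‖charFun ν (c * t)‖ ^ 2 : ℝ) : ℂ) := by
    have := hν 0 t
    rw [hone, one_mul, zero_add, zero_sub, mul_neg, charFun_neg, Complex.mul_conj'] at this
    exact_mod_cast this
  set f : ℝ → ℝ := fun t => ‖charFun ν t‖ with hf
  have hfc : Continuous f := continuous_charFun.norm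
  have hφf (t : ℝ) : charFun ν t = f t := by
    have h₁ := hnorm t
    rw [hf]
    dsimp only
    rw [h₁, Complex.norm_real, Real.norm_of_nonneg (by positivity)]
  have hf0 : f 0 = 1 := by simp [hf, hone]
  have hsq (t : ℝ) : f t = f (c * t) ^ 2 := by
    have := hnorm t
    rw [hφf t] at this
    exact_mod_cast this
  have hc_abs : |c| < 1 := by
    rw [abs_of_pos (by positivity)]
    exact inv_lt_one_of_one_lt₀ (Real.lt_sqrt_of_sq_lt (by norm_num))
  have hne (t : ℝ) : f t ≠ 0 := by
    intro ht
    have hz (n : ℕ) : f (c ^ n * t) = 0 := by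
      induction n with
      | zero => simpa using ht
      | succ n ih =>
        rw [hsq, ← mul_assoc, ← pow_succ'] at ih
        exact pow_eq_zero_iff two_ne_zero |>.1 ih
    have hlim : Filter.Tendsto (fun n : ℕ => f (c ^ n * t)) Filter.atTop (nhds (f (0 * t))) :=
      (hfc.tendsto _).comp ((tendsto_pow_atTop_nhds_zero_of_abs_lt_one hc_abs).mul_const t)
    simp only [hz, zero_mul, hf0] at hlim
    exact zero_ne_one (tendsto_nhds_unique tendsto_const_nhds hlim)
  have hmul (s t : ℝ) : f (s + t) * f (s - t) = f s ^ 2 * f t ^ 2 := by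
    have h₁ := hν (Real.sqrt 2 * s) (Real.sqrt 2 * t)
    rw [← mul_add, ← mul_sub, ← mul_assoc, ← mul_assoc, hcs, one_mul, one_mul] at h₁
    simp only [hφf] at h₁
    have h₂ : f (Real.sqrt 2 * s) * f (Real.sqrt 2 * t) = f (s + t) * f (s - t) := by
      exact_mod_cast h₁
    rw [← h₂, hsq (Real.sqrt 2 * s), hsq (Real.sqrt 2 * t), ← mul_assoc, ← mul_assoc, hcs,
      one_mul, one_mul]
  have hquad := eq_mul_sq_of_quadratic (h := fun t => Real.log (f t)) (hfc.log hne) (by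
    intro s t
    rw [← Real.log_mul (hne _) (hne _), hmul, Real.log_mul (pow_ne_zero 2 (hne _))
      (pow_ne_zero 2 (hne _)), Real.log_pow, Real.log_pow]
    push_cast
    rfl)
  have hlog : Real.log (f 1) ≤ 0 := Real.log_nonpos (norm_nonneg _) (norm_charFun_le_one _)
  obtain ⟨v, hv⟩ : ∃ v : NNReal, (v : ℝ) = -2 * Real.log (f 1) :=
    ⟨⟨-2 * Real.log (f 1), by linarith⟩, rfl⟩
  refine ⟨v, Measure.ext_of_charFun (funext fun t => ?_)⟩
  have hft : f t = Real.exp (Real.log (f 1) * t ^ 2) := by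
    rw [← hquad t, Real.exp_log (lt_of_le_of_ne (norm_nonneg _) (hne t).symm)]
  have hexp : Real.log (f 1) * t ^ 2 = -(v * t ^ 2 / 2) := by rw [hv]; ring
  rw [charFun_gaussianReal, hφf, hft, hexp]
  push_cast
  congr 1
  simp

theorem fernique_converse_rotation
    {E : Type*}
    [NormedAddCommGroup E] [NormedSpace ℝ E] [CompleteSpace E]
    [TopologicalSpace.SeparableSpace E]
    [MeasurableSpace E] [BorelSpace E]
    (μ : Measure E) [IsProbabilityMeasure μ]
    {Ω : Type*} [MeasurableSpace Ω] (P : Measure Ω) [IsProbabilityMeasure P]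
    (X Y : Ω → E) (hX : Measurable X) (hY : Measurable Y)
    (hXlaw : P.map X = μ) (hYlaw : P.map Y = μ)
    (hindep : IndepFun X Y P)
    (hrot : P.map (fun ω => ((Real.sqrt 2)⁻¹ • (X ω + Y ω), (Real.sqrt 2)⁻¹ • (X ω - Y ω)))
      = P.map (fun ω => (X ω, Y ω))) :
    IsCenteredGaussian μ := by
  refine ⟨inferInstance, fun L => ?_⟩
  have : SecondCountableTopology E := UniformSpace.secondCountable_of_separable E
  have hprod : P.map (fun ω => (X ω, Y ω)) = μ.prod μ := by
    rw [(indepFun_iff_map_prod_eq_prod_map_map hX.aemeasurable hY.aemeasurable).1 hindep,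
      hXlaw, hYlaw]
  have hinv : (μ.prod μ).map (fun p => ((Real.sqrt 2)⁻¹ • (p.1 + p.2),
      (Real.sqrt 2)⁻¹ • (p.1 - p.2))) = μ.prod μ := by
    rw [← hprod, Measure.map_map (by fun_prop) (hX.prodMk hY)]
    exact hrot
  have : IsProbabilityMeasure (μ.map L) :=
    Measure.isProbabilityMeasure_map L.continuous.aemeasurable
  refine exists_eq_gaussianReal_of_charFun_mul_charFun fun s t => ?_
  simp only [charFun_map_eq_charFunDual_smul]
  have hsub : (s - t) • L = s • L - t • L := by ext x; simp [sub_mul]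
  rw [mul_smul, mul_smul, add_smul, hsub]
  exact charFunDual_mul_charFunDual_of_map_prod_eq hinv (s • L) (t • L)
end

section
/- Let E and F be real separable Banach spaces and let ψ : E → F be an additive map whose graph {(x, ψ(x)) : x ∈ E} is a Borel subset of E × F. Then ψ is continuous and ℝ-linear. -/
open Filter Topology in
/-- **Pettis lemma**: in a Baire topological additive group, the difference set of a nonmeagre
set with the Baire property is a neighbourhood of zero. -/
theorem BaireMeasurableSet.exists_sub_mem_nhds_zero {G : Type*} [AddGroup G] [TopologicalSpace G]
    [IsTopologicalAddGroup G] [BaireSpace G] {A : Set G} (hA : BaireMeasurableSet A)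
    (hne : ¬ IsMeagre A) : {x : G | ∃ a ∈ A, ∃ b ∈ A, a - b = x} ∈ 𝓝 0 := by
  obtain ⟨U, hU, hAU⟩ := hA.residualEq_isOpen
  have hUne : U.Nonempty := by
    rw [Set.nonempty_iff_ne_empty]
    rintro rfl
    refine hne ?_
    filter_upwards [hAU] with x hx hxA
    exact hx.mp hxA
  obtain ⟨u, hu⟩ := hUne
  have hmem : (fun x : G => x + u) ⁻¹' U ∈ 𝓝 (0 : G) :=
    (continuous_add_const u).continuousAt.preimage_mem_nhds (by simpa using hU.mem_nhds hu)
  filter_upwards [hmem] with x hx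
  have htrans : ∀ᶠ y in residual G, x + y ∈ A ↔ x + y ∈ U :=
    (tendsto_residual_of_isOpenMap (continuous_const_add x)
      (Homeomorph.addLeft x).isOpenMap).eventually hAU.mem_iff
  have hVopen : IsOpen (U ∩ (fun y => x + y) ⁻¹' U) :=
    hU.inter (hU.preimage (continuous_const_add x))
  obtain ⟨y, ⟨hyU, hxyU⟩, hy, hxy⟩ :=
    (dense_of_mem_residual (hAU.mem_iff.and htrans)).inter_open_nonempty _ hVopen ⟨u, hu, hx⟩
  exact ⟨x + y, hxy.mpr hxyU, y, hy.mpr hyU, add_sub_cancel_right x y⟩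

/-- A function between standard Borel spaces whose graph is measurable is measurable. -/
theorem measurable_of_measurableSet_graph {X Y : Type*} [MeasurableSpace X]
    [StandardBorelSpace X] [MeasurableSpace Y] [StandardBorelSpace Y] {f : X → Y}
    (hf : MeasurableSet {p : X × Y | p.2 = f p.1}) : Measurable f := by
  intro s hs
  have himage : f ⁻¹' s = Prod.fst '' ({p : X × Y | p.2 = f p.1} ∩ Prod.snd ⁻¹' s) := by
    ext x
    simp
  rw [himage]
  refine (hf.inter (measurable_snd hs)).image_of_measurable_injOn measurable_fst ?_
  rintro ⟨x, y⟩ ⟨hy, -⟩ ⟨x', y'⟩ ⟨hy', -⟩ (rfl : x = x')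
  exact Prod.ext rfl (hy.trans hy'.symm)

open Filter Topology in
/-- A Borel measurable homomorphism from a Baire topological group to a separable seminormed group
is continuous. -/
theorem AddMonoidHom.continuous_of_measurable_of_baireSpace {G H : Type*} [AddGroup G]
    [TopologicalSpace G] [IsTopologicalAddGroup G] [BaireSpace G] [MeasurableSpace G] [BorelSpace G]
    [SeminormedAddCommGroup H] [TopologicalSpace.SeparableSpace H] [MeasurableSpace H]
    [OpensMeasurableSpace H] (f : G →+ H) (hf : Measurable f) : Continuous f := by
  refine continuous_of_continuousAt_zero f ?_
  rw [ContinuousAt, map_zero, Metric.tendsto_nhds]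
  intro ε hε
  let A : ℕ → Set G := fun n => f ⁻¹' Metric.ball (TopologicalSpace.denseSeq H n) (ε / 2)
  have hcover : ⋃ n, A n = Set.univ := by
    refine Set.eq_univ_of_forall fun x => Set.mem_iUnion.mpr ?_
    obtain ⟨n, hn⟩ :=
      (TopologicalSpace.denseRange_denseSeq H).exists_dist_lt (f x) (half_pos hε)
    exact ⟨n, hn⟩
  obtain ⟨n, hn⟩ : ∃ n, ¬ IsMeagre (A n) := by
    by_contra! h
    have hmeagre := isMeagre_iUnion h
    rw [hcover] at hmeagre
    exact not_isMeagre_of_isOpen isOpen_univ Set.univ_nonempty hmeagre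
  have hA : MeasurableSet (A n) := hf Metric.isOpen_ball.measurableSet
  filter_upwards [hA.baireMeasurableSet.exists_sub_mem_nhds_zero hn]
  rintro _ ⟨a, ha, b, hb, rfl⟩
  rw [map_sub, dist_zero_right, ← dist_eq_norm]
  calc dist (f a) (f b) ≤ dist (f a) (TopologicalSpace.denseSeq H n)
        + dist (f b) (TopologicalSpace.denseSeq H n) := dist_triangle_right _ _ _
    _ < ε / 2 + ε / 2 := add_lt_add ha hb
    _ = ε := add_halves ε

theorem additive_borel_graph_implies_continuous_linear
    {E F : Type*}
    [NormedAddCommGroup E] [NormedSpace ℝ E] [CompleteSpace E]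
    [TopologicalSpace.SeparableSpace E]
    [NormedAddCommGroup F] [NormedSpace ℝ F] [CompleteSpace F]
    [TopologicalSpace.SeparableSpace F]
    [MeasurableSpace E] [BorelSpace E] [MeasurableSpace F] [BorelSpace F]
    (ψ : E → F) (hadd : ∀ x y : E, ψ (x + y) = ψ x + ψ y)
    (hgraph : MeasurableSet {p : E × F | p.2 = ψ p.1}) :
    Continuous ψ ∧ IsLinearMap ℝ ψ := by
  have : SecondCountableTopology E := UniformSpace.secondCountable_of_separable E
  have : SecondCountableTopology F := UniformSpace.secondCountable_of_separable F
  have hcont : Continuous (AddMonoidHom.mk' ψ hadd) :=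
    (AddMonoidHom.mk' ψ hadd).continuous_of_measurable_of_baireSpace
      (measurable_of_measurableSet_graph hgraph)
  exact ⟨hcont, ((AddMonoidHom.mk' ψ hadd).toRealLinearMap hcont).toLinearMap.isLinear⟩
end
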